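/- Lemma: If M ∈ ARI(Γ) is bialternal, then for every m ≥ 1 and all σ_1,…,σ_m ∈ Γ: (neg-invariance) swap(M)^m(v_1,…,v_m ; σ_1,…,σ_m) = swap(M)^m(−v_1,…,−v_m ; σ_1^{−1},…,σ_m^{−1}), and (mantar∘neg-invariance) swap(M)^m(v_1,…,v_m ; σ_1,…,σ_m) = (−1)^{m−1} · swap(M)^m(−v_m,…,−v_1 ; σ_m^{−1},…,σ_1^{−1}). -/

import Mathlib

namespace KVMould

/-- A mould over `Γ` in evaluation form: the depth-`m` component
`M m σ x` is the value of the rational function `M^m_{σ₁,…,σₘ}` at the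
rational point `x = (x₁,…,xₘ)` (indices are 0-based). -/
abbrev Mould (Γ : Type) : Type := (m : ℕ) → (Fin m → Γ) → (Fin m → ℚ) → ℚ

variable {Γ : Type} [CommGroup Γ]

/-- `M ∈ ARI(Γ)`: the depth `0` component vanishes. -/
def IsARI (M : Mould Γ) : Prop := ∀ σ x, M 0 σ x = 0

/-- Extension of a tuple of rationals by `0` outside the range. -/
def extQ {m : ℕ} (x : Fin m → ℚ) : ℕ → ℚ := fun i => if h : i < m then x ⟨i, h⟩ else 0

/-- Extension of a tuple of group elements by `1` outside the range. -/
def extG {m : ℕ} (σ : Fin m → Γ) : ℕ → Γ := fun i => if h : i < m then σ ⟨i, h⟩ else 1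

/-- The (noncommutative, nonunital on `ARI`) mould product `A × B`. -/
def mouldMul (A B : Mould Γ) : Mould Γ := fun m σ x =>
  ∑ k ∈ Finset.range (m + 1),
    A k (fun j => extG σ j.val) (fun j => extQ x j.val) *
      B (m - k) (fun j => extG σ (k + j.val)) (fun j => extQ x (k + j.val))

/-- Ecalle's derivation `arit_u(B)(A)` (0-indexed form of the paper's
Definition of `arit_u`; the blocks `k ≤ l` below are 0-based). -/
def aritU (B A : Mould Γ) : Mould Γ := fun m σ x =>
  (∑ k ∈ Finset.range m, ∑ l ∈ Finset.range m,
    if k ≤ l ∧ l + 1 < m then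
      A (m - (l - k + 1))
        (fun j => if j.val < k then extG σ j.val
          else if j.val = k then extG σ (l + 1)
          else extG σ (j.val + (l - k + 1)))
        (fun j => if j.val < k then extQ x j.val
          else if j.val = k then ∑ i ∈ Finset.Icc k (l + 1), extQ x i
          else extQ x (j.val + (l - k + 1))) *
      B (l - k + 1)
        (fun j => extG σ (k + j.val) * (extG σ (l + 1))⁻¹)
        (fun j => extQ x (k + j.val))
    else 0)
  -
  (∑ k ∈ Finset.range m, ∑ l ∈ Finset.range m,
    if 1 ≤ k ∧ k ≤ l then
      A (m - (l - k + 1))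
        (fun j => if j.val < k - 1 then extG σ j.val
          else if j.val = k - 1 then extG σ (k - 1)
          else extG σ (j.val + (l - k + 1)))
        (fun j => if j.val < k - 1 then extQ x j.val
          else if j.val = k - 1 then ∑ i ∈ Finset.Icc (k - 1) l, extQ x i
          else extQ x (j.val + (l - k + 1))) *
      B (l - k + 1)
        (fun j => extG σ (k + j.val) * (extG σ (k - 1))⁻¹)
        (fun j => extQ x (k + j.val))
    else 0)

/-- The `ari_u`-bracket: `ari_u(A,B) = arit_u(B)(A) − arit_u(A)(B) + A×B − B×A`. -/
def ariU (A B : Mould Γ) : Mould Γ :=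
  aritU B A - aritU A B + mouldMul A B - mouldMul B A

/-- `preari_u(A,B) = arit_u(B)(A) + A×B`. -/
def preariU (A B : Mould Γ) : Mould Γ := aritU B A + mouldMul A B

/-- The set of shuffle permutations `Sh(p,q)`. -/
def shuffles (p q : ℕ) : Finset (Equiv.Perm (Fin (p + q))) :=
  Finset.univ.filter fun τ =>
    (∀ i j : Fin (p + q), i.val < j.val → j.val < p → τ⁻¹ i < τ⁻¹ j) ∧
    (∀ i j : Fin (p + q), i.val < j.val → p ≤ i.val → τ⁻¹ i < τ⁻¹ j)

/-- Alternality of a mould. -/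
def IsAlternal (M : Mould Γ) : Prop :=
  ∀ p q : ℕ, 1 ≤ p → 1 ≤ q → ∀ (σ : Fin (p + q) → Γ) (x : Fin (p + q) → ℚ),
    ∑ τ ∈ shuffles p q, M (p + q) (fun i => σ (τ i)) (fun i => x (τ i)) = 0

/-- The `swap` of a mould. -/
def swapM (M : Mould Γ) : Mould Γ := fun m σ v =>
  M m (fun i => ∏ j ∈ Finset.range (m - i.val), extG σ j)
    (fun i => extQ v (m - 1 - i.val) - extQ v (m - i.val))

/-- Bialternality: `M` and `swap(M)` are alternal and the depth `1`
component is even (`M¹(x₁;σ₁) = M¹(−x₁;σ₁⁻¹)`). -/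
def IsBialternal (M : Mould Γ) : Prop :=
  IsAlternal M ∧ IsAlternal (swapM M) ∧
    ∀ (σ : Γ) (t : ℚ), M 1 (fun _ => σ) (fun _ => t) = M 1 (fun _ => σ⁻¹) (fun _ => -t)

/-- The `push` operator. -/
def pushM (M : Mould Γ) : Mould Γ := fun m σ x =>
  M m
    (fun i => if i.val = 0 then (extG σ (m - 1))⁻¹
      else extG σ (i.val - 1) * (extG σ (m - 1))⁻¹)
    (fun i => if i.val = 0 then -(∑ j ∈ Finset.range m, extQ x j)
      else extQ x (i.val - 1))

/-- The `v`-variant `arit_v(B)(A)`. -/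
def aritV (B A : Mould Γ) : Mould Γ := fun m σ v =>
  (∑ k ∈ Finset.range m, ∑ l ∈ Finset.range m,
    if k ≤ l ∧ l + 1 < m then
      A (m - (l - k + 1))
        (fun j => if j.val < k then extG σ j.val
          else if j.val = k then ∏ i ∈ Finset.Icc k (l + 1), extG σ i
          else extG σ (j.val + (l - k + 1)))
        (fun j => if j.val < k then extQ v j.val
          else if j.val = k then extQ v (l + 1)
          else extQ v (j.val + (l - k + 1))) *
      B (l - k + 1)
        (fun j => extG σ (k + j.val))
        (fun j => extQ v (k + j.val) - extQ v (l + 1))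
    else 0)
  -
  (∑ k ∈ Finset.range m, ∑ l ∈ Finset.range m,
    if 1 ≤ k ∧ k ≤ l then
      A (m - (l - k + 1))
        (fun j => if j.val < k - 1 then extG σ j.val
          else if j.val = k - 1 then ∏ i ∈ Finset.Icc (k - 1) l, extG σ i
          else extG σ (j.val + (l - k + 1)))
        (fun j => if j.val < k - 1 then extQ v j.val
          else if j.val = k - 1 then extQ v (k - 1)
          else extQ v (j.val + (l - k + 1))) *
      B (l - k + 1)
        (fun j => extG σ (k + j.val))
        (fun j => extQ v (k + j.val) - extQ v (k - 1))
    else 0)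

/-- The `ari_v`-bracket. -/
def ariV (A B : Mould Γ) : Mould Γ :=
  aritV B A - aritV A B + mouldMul A B - mouldMul B A

/-- Pus-neutrality: all cyclic shifts of every component sum to zero. -/
def IsPusNeutral (N : Mould Γ) : Prop :=
  ∀ m : ℕ, 1 ≤ m → ∀ (σ : Fin m → Γ) (v : Fin m → ℚ),
    ∑ i ∈ Finset.range m,
      N m (fun j => extG σ ((i + j.val) % m)) (fun j => extQ v ((i + j.val) % m)) = 0

/-- The subgroup `Γ^N = {g^N : g ∈ Γ}`. -/
def powSubgroup (Γ : Type) [CommGroup Γ] (N : ℕ) : Subgroup Γ :=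
  MonoidHom.range (powMonoidHom N)

/-- The map `i_N : ARI(Γ) → ARI(Γ^N)` (restriction of indices). -/
def iN (N : ℕ) (M : Mould Γ) : Mould (powSubgroup Γ N) := fun m σ x =>
  M m (fun i => (σ i : Γ)) x

/-- The map `m_N : ARI(Γ) → ARI(Γ^N)`. -/
def mN [Fintype Γ] [DecidableEq Γ] (N : ℕ) (M : Mould Γ) :
    Mould (powSubgroup Γ N) := fun m σ x =>
  ∑ τ ∈ Finset.univ.filter (fun τ : Fin m → Γ => ∀ i, τ i ^ N = (σ i : Γ)),
    M m τ (fun i => (N : ℚ) * x i)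

/-- `M` satisfies the distribution relations. -/
def IsARID [Fintype Γ] [DecidableEq Γ] (M : Mould Γ) : Prop :=
  ∀ N : ℕ, 1 ≤ N → N ∣ Fintype.card Γ → iN N M = mN N M

/-- The parallel translation map `t`. -/
def tMap (P : Mould Γ) : Mould Γ := fun m σ v =>
  if m ≤ 1 then P m σ v
  else P (m - 1) (fun j => extG σ (j.val + 1)) (fun j => extQ v (j.val + 1) - extQ v 0)

/-- `ũ := t ∘ swap`. -/
def uTilde (M : Mould Γ) : Mould Γ := tMap (swapM M)

/-- Permutations whose inverse is increasing on `[0, k)` and on `[k, n)`. -/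
def shufflesAt (n k : ℕ) : Finset (Equiv.Perm (Fin n)) :=
  Finset.univ.filter fun τ =>
    (∀ i j : Fin n, i.val < j.val → j.val < k → τ⁻¹ i < τ⁻¹ j) ∧
    (∀ i j : Fin n, i.val < j.val → k ≤ i.val → τ⁻¹ i < τ⁻¹ j)

theorem IsAlternal.sum_shufflesAt {Γ : Type} {M : Mould Γ} (h : IsAlternal M) {n k : ℕ} (hk : 1 ≤ k)
    (hkn : k < n) (σ : Fin n → Γ) (x : Fin n → ℚ) :
    ∑ τ ∈ shufflesAt n k, M n (fun i => σ (τ i)) (fun i => x (τ i)) = 0 := by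
  obtain ⟨q, rfl⟩ := Nat.exists_eq_add_of_lt hkn
  exact h k (q + 1) hk (by omega) σ x

/-- Permutations whose inverse is decreasing on `[0, k)` and increasing on `[k, n)`. -/
def revShufflesAt (n k : ℕ) : Finset (Equiv.Perm (Fin n)) :=
  Finset.univ.filter fun τ =>
    (∀ i j : Fin n, i.val < j.val → j.val < k → τ⁻¹ j < τ⁻¹ i) ∧
    (∀ i j : Fin n, i.val < j.val → k ≤ i.val → τ⁻¹ i < τ⁻¹ j)

/-- Permutations whose inverse is decreasing on `[0, k]` and increasing on `[k, n)`. -/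
def valleyPerms (n k : ℕ) : Finset (Equiv.Perm (Fin n)) :=
  Finset.univ.filter fun τ =>
    (∀ i j : Fin n, i.val < j.val → j.val ≤ k → τ⁻¹ j < τ⁻¹ i) ∧
    (∀ i j : Fin n, i.val < j.val → k ≤ i.val → τ⁻¹ i < τ⁻¹ j)

/-- The involution of `Fin n` reversing the initial segment `[0, k)`. -/
def initialRev (n k : ℕ) (hkn : k < n) : Equiv.Perm (Fin n) :=
  Function.Involutive.toPerm
    (fun i => if h : i.val < k then ⟨k - 1 - i.val, by omega⟩ else i) (by
      intro i
      by_cases h : i.val < k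
      · have h' : k - 1 - i.val < k := by omega
        simp only [h, h', dite_true, Fin.ext_iff]
        omega
      · simp [h])

theorem initialRev_val (n k : ℕ) (hkn : k < n) (i : Fin n) :
    (initialRev n k hkn i).val = if i.val < k then k - 1 - i.val else i.val := by
  change (if h : i.val < k then (⟨k - 1 - i.val, by omega⟩ : Fin n) else i).val = _
  split_ifs <;> rfl

theorem initialRev_inv (n k : ℕ) (hkn : k < n) :
    (initialRev n k hkn)⁻¹ = initialRev n k hkn := rfl

theorem initialRev_mul_self (n k : ℕ) (hkn : k < n) :
    initialRev n k hkn * initialRev n k hkn = 1 := by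
  nth_rewrite 1 [← initialRev_inv]
  exact inv_mul_cancel _

theorem initialRev_mul_mem_revShufflesAt {n k : ℕ} (hkn : k < n) {τ : Equiv.Perm (Fin n)}
    (h : τ ∈ shufflesAt n k) : initialRev n k hkn * τ ∈ revShufflesAt n k := by
  simp only [shufflesAt, revShufflesAt, Finset.mem_filter, Finset.mem_univ, true_and, mul_inv_rev,
    initialRev_inv, Equiv.Perm.mul_apply] at h ⊢
  refine ⟨fun i j hij hj => h.1 _ _ ?_ ?_, fun i j hij hi => h.2 _ _ ?_ ?_⟩ <;>
    simp only [initialRev_val] <;> grind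

theorem initialRev_mul_mem_shufflesAt {n k : ℕ} (hkn : k < n) {τ : Equiv.Perm (Fin n)}
    (h : τ ∈ revShufflesAt n k) : initialRev n k hkn * τ ∈ shufflesAt n k := by
  simp only [shufflesAt, revShufflesAt, Finset.mem_filter, Finset.mem_univ, true_and, mul_inv_rev,
    initialRev_inv, Equiv.Perm.mul_apply] at h ⊢
  refine ⟨fun i j hij hj => h.1 _ _ ?_ ?_, fun i j hij hi => h.2 _ _ ?_ ?_⟩ <;>
    simp only [initialRev_val] <;> grind

theorem IsAlternal.sum_revShufflesAt {Γ : Type} {M : Mould Γ} (h : IsAlternal M) {n k : ℕ} (hk : 1 ≤ k)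
    (hkn : k < n) (σ : Fin n → Γ) (x : Fin n → ℚ) :
    ∑ τ ∈ revShufflesAt n k, M n (fun i => σ (τ i)) (fun i => x (τ i)) = 0 := by
  rw [← h.sum_shufflesAt hk hkn (fun i => σ (initialRev n k hkn i))
    (fun i => x (initialRev n k hkn i))]
  refine Finset.sum_bij' (fun τ _ => initialRev n k hkn * τ) (fun τ _ => initialRev n k hkn * τ)
    (fun _ => initialRev_mul_mem_shufflesAt hkn) (fun _ => initialRev_mul_mem_revShufflesAt hkn)
    ?_ ?_ ?_
  · intro τ _
    simp only [← mul_assoc, initialRev_mul_self, one_mul]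
  · intro τ _
    simp only [← mul_assoc, initialRev_mul_self, one_mul]
  · intro τ _
    simp only [← Equiv.Perm.mul_apply, ← mul_assoc, initialRev_mul_self, one_mul]

theorem sum_revShufflesAt_succ {n k : ℕ} (hkn : k + 1 < n) (φ : Equiv.Perm (Fin n) → ℚ) :
    ∑ τ ∈ revShufflesAt n (k + 1), φ τ =
      ∑ τ ∈ valleyPerms n k, φ τ + ∑ τ ∈ valleyPerms n (k + 1), φ τ := by
  have hk : k < n := by omega
  rw [← Finset.sum_filter_add_sum_filter_not (revShufflesAt n (k + 1))
    (fun τ => τ⁻¹ ⟨k, hk⟩ < τ⁻¹ ⟨k + 1, hkn⟩)]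
  congr 2
  · ext τ
    simp only [revShufflesAt, valleyPerms, Finset.mem_filter, Finset.mem_univ, true_and]
    constructor
    · rintro ⟨⟨h1, h2⟩, h3⟩
      refine ⟨fun i j hij hj => h1 i j hij (by omega), fun i j hij hi => ?_⟩
      rcases Nat.lt_or_ge k i.val with hki | hki
      · exact h2 i j hij hki
      · obtain rfl : i = ⟨k, hk⟩ := Fin.ext (by simp; omega)
        rcases Nat.lt_or_ge (k + 1) j.val with hkj | hkj
        · exact h3.trans (h2 _ _ hkj le_rfl)
        · obtain rfl : j = ⟨k + 1, hkn⟩ := Fin.ext (by simp at hij ⊢; omega)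
          exact h3
    · rintro ⟨h1, h2⟩
      exact ⟨⟨fun i j hij hj => h1 i j hij (by omega), fun i j hij hi => h2 i j hij (by omega)⟩,
        h2 _ _ (by simp) le_rfl⟩
  · ext τ
    simp only [revShufflesAt, valleyPerms, Finset.mem_filter, Finset.mem_univ, true_and, not_lt]
    constructor
    · rintro ⟨⟨h1, h2⟩, h3⟩
      have h3 : τ⁻¹ ⟨k + 1, hkn⟩ < τ⁻¹ ⟨k, hk⟩ :=
        lt_of_le_of_ne h3 fun h => by simpa using τ⁻¹.injective h
      refine ⟨fun i j hij hj => ?_, fun i j hij hi => h2 i j hij hi⟩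
      rcases Nat.lt_or_ge j.val (k + 1) with hkj | hkj
      · exact h1 i j hij hkj
      · obtain rfl : j = ⟨k + 1, hkn⟩ := Fin.ext (by simp; omega)
        rcases Nat.lt_or_ge i.val k with hki | hki
        · exact h3.trans (h1 _ _ hki (by simp))
        · obtain rfl : i = ⟨k, hk⟩ := Fin.ext (by simp at hij ⊢; omega)
          exact h3
    · rintro ⟨h1, h2⟩
      exact ⟨⟨fun i j hij hj => h1 i j hij (by omega), fun i j hij hi => h2 i j hij (by omega)⟩,
        (h1 _ _ (by simp) le_rfl).le⟩

theorem perm_eq_one_of_strictMono {n : ℕ} {τ : Equiv.Perm (Fin n)} (h : StrictMono τ) : τ = 1 := by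
  ext1 i
  exact congrFun ((h.range_inj strictMono_id).1 (by simp [τ.surjective.range_eq])) i

theorem valleyPerms_zero (n : ℕ) : valleyPerms n 0 = {1} := by
  ext τ
  simp only [valleyPerms, Finset.mem_filter, Finset.mem_univ, true_and, Finset.mem_singleton]
  constructor
  · rintro ⟨-, h⟩
    exact inv_eq_one.1 (perm_eq_one_of_strictMono fun i j hij => h i j hij (Nat.zero_le _))
  · rintro rfl
    exact ⟨fun i j hij hj => by omega, fun i j hij _ => hij⟩

theorem valleyPerms_last (n : ℕ) : valleyPerms (n + 1) n = {Fin.revPerm} := by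
  ext τ
  simp only [valleyPerms, Finset.mem_filter, Finset.mem_univ, true_and, Finset.mem_singleton]
  constructor
  · rintro ⟨h, -⟩
    have : τ⁻¹ * Fin.revPerm = 1 := perm_eq_one_of_strictMono fun i j hij =>
      h _ _ (Fin.rev_lt_rev.2 hij) (by omega)
    rw [inv_mul_eq_one] at this
    exact this
  · rintro rfl
    exact ⟨fun i j hij hj => Fin.rev_lt_rev.2 hij, fun i j hij hi => by omega⟩

/-- Alternal moulds are `mantar`-invariant. -/
theorem IsAlternal.mantar {Γ : Type} {M : Mould Γ} (h : IsAlternal M) (n : ℕ)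
    (σ : Fin (n + 1) → Γ) (x : Fin (n + 1) → ℚ) :
    M (n + 1) σ x = (-1) ^ n * M (n + 1) (fun i => σ i.rev) (fun i => x i.rev) := by
  have key : ∀ k ≤ n, ∑ τ ∈ valleyPerms (n + 1) k,
      M (n + 1) (fun i => σ (τ i)) (fun i => x (τ i)) = (-1) ^ k * M (n + 1) σ x := by
    intro k
    induction k with
    | zero => simp [valleyPerms_zero]
    | succ k ih =>
      intro hk
      have h1 := h.sum_revShufflesAt (k := k + 1) (by omega) (by omega : k + 1 < n + 1) σ x
      rw [sum_revShufflesAt_succ (by omega), ih (by omega)] at h1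
      rw [pow_succ]
      linarith
  have h2 := key n le_rfl
  rw [valleyPerms_last, Finset.sum_singleton] at h2
  simp only [Fin.revPerm_apply] at h2
  rw [h2, ← mul_assoc, ← mul_pow]
  simp

theorem shufflesAt_one (q : ℕ) :
    shufflesAt (q + 1) 1 = Finset.univ.image (Fin.cycleRange : Fin (q + 1) → _) := by
  ext τ
  simp only [shufflesAt, Finset.mem_filter, Finset.mem_univ, true_and, Finset.mem_image]
  constructor
  · rintro ⟨-, h⟩
    refine ⟨τ⁻¹ 0, ?_⟩
    have hmono : StrictMono fun j : Fin q => τ⁻¹ j.succ := fun i j hij =>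
      h _ _ (by simpa using hij) (by simp)
    have heq : (fun j : Fin q => τ⁻¹ j.succ) = (τ⁻¹ 0).succAbove := by
      refine (hmono.range_inj (Fin.strictMono_succAbove _)).1 ?_
      rw [Fin.range_succAbove]
      change Set.range (⇑τ⁻¹ ∘ Fin.succ) = _
      rw [Set.range_comp, Fin.range_succ, Set.image_compl_eq (Equiv.bijective τ⁻¹), Set.image_singleton]
    have : (Fin.cycleRange (τ⁻¹ 0))⁻¹ = τ⁻¹ := by
      ext1 j
      cases j using Fin.cases with
      | zero => exact Fin.cycleRange_symm_zero _
      | succ j => exact (Fin.cycleRange_symm_succ _ _).trans (congrFun heq j).symm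
    exact inv_injective this
  · rintro ⟨i, rfl⟩
    refine ⟨fun a b hab hb => by omega, fun a b hab ha => ?_⟩
    obtain ⟨a, rfl⟩ := Fin.exists_succ_eq.2 (by rintro rfl; simp at ha : a ≠ 0)
    obtain ⟨b, rfl⟩ := Fin.exists_succ_eq.2 (by rintro rfl; simp at hab : b ≠ 0)
    change i.cycleRange.symm _ < i.cycleRange.symm _
    rw [Fin.cycleRange_symm_succ, Fin.cycleRange_symm_succ]
    exact Fin.strictMono_succAbove _ (by simpa using hab)

theorem IsAlternal.sum_insertNth {Γ : Type} {M : Mould Γ} (h : IsAlternal M) {q : ℕ} (hq : 1 ≤ q)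
    (a : Γ × ℚ) (b : Fin q → Γ × ℚ) :
    ∑ i : Fin (q + 1), M (q + 1) (fun j => ((i.insertNth a b : _ → Γ × ℚ) j).1)
      (fun j => ((i.insertNth a b : _ → Γ × ℚ) j).2) = 0 := by
  have h1 := h.sum_shufflesAt (n := q + 1) le_rfl (by omega)
    (fun j => ((Fin.cons a b : _ → Γ × ℚ) j).1) (fun j => ((Fin.cons a b : _ → Γ × ℚ) j).2)
  rw [shufflesAt_one, Finset.sum_image] at h1
  · simpa only [Fin.cons_apply_cycleRange] using h1
  · intro i _ j _ hij
    have h0 := congrArg (fun τ : Equiv.Perm (Fin (q + 1)) => τ.symm 0) hij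
    simpa using h0

theorem insertNth_comp_eq {X : Type} {n : ℕ} (ρ : Equiv.Perm (Fin (n + 1)))
    (π : Equiv.Perm (Fin n)) (a : X) (b : Fin n → X) {p p' : Fin (n + 1)} (hp : ρ p = p')
    (h : ∀ j, ρ (p.succAbove j) = p'.succAbove (π j)) :
    (p.insertNth a (b ∘ π) : Fin (n + 1) → X) = (p'.insertNth a b : Fin (n + 1) → X) ∘ ρ := by
  refine Fin.insertNth_eq_iff.2 ⟨?_, ?_⟩
  · rw [Function.comp_apply, hp, Fin.insertNth_apply_same]
  · ext j
    rw [Fin.removeNth, Function.comp_apply, Function.comp_apply, h, Fin.insertNth_apply_succAbove]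

theorem comp_insertNth {X Y : Type} {n : ℕ} (f : X → Y) (p : Fin (n + 1)) (a : X) (b : Fin n → X) :
    (fun j => f ((p.insertNth a b : Fin (n + 1) → X) j)) =
      (p.insertNth (f a) (fun j => f (b j)) : Fin (n + 1) → Y) := by
  refine Fin.eq_insertNth_iff.2 ⟨?_, ?_⟩
  · rw [Fin.insertNth_apply_same]
  · ext j
    rw [Fin.removeNth, Fin.insertNth_apply_succAbove]

/-- A function of words of length `q + 3` which changes sign under cyclic rotation and which, for
a fixed first letter, kills the shuffles of one letter with the remaining ones, vanishes. -/
theorem eq_zero_of_rotate_eq_neg {X : Type} {q : ℕ} (G : (Fin (q + 3) → X) → ℚ)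
    (hrot : ∀ w, G (w ∘ finRotate (q + 3)) = -G w)
    (hsh : ∀ a b, ∑ i : Fin (q + 2), G (i.succ.insertNth a b) = 0) (w : Fin (q + 3) → X) :
    G w = 0 := by
  have key : ∀ (a : X) (b : Fin (q + 2) → X),
      G ((0 : Fin (q + 2)).succ.insertNth a b) = 0 := by
    intro a b
    have h1 := hsh a b
    have h2 := hsh a (b ∘ finRotate (q + 2))
    rw [Fin.sum_univ_succ] at h1
    rw [Fin.sum_univ_castSucc] at h2
    have h3 : ∀ i : Fin (q + 1), G (i.castSucc.succ.insertNth a (b ∘ finRotate (q + 2))) =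
        -G (i.succ.succ.insertNth a b) := by
      intro i
      rw [← hrot]
      congr 1
      refine insertNth_comp_eq (finRotate (q + 3)) (finRotate (q + 2)) a b ?_ fun j => ?_
      · ext
        rw [coe_finRotate, if_neg (by simp [Fin.ext_iff, i.isLt.ne])]
        simp
      · ext
        simp only [coe_finRotate, Fin.succAbove, Fin.ext_iff, Fin.lt_def, apply_ite Fin.val,
          Fin.val_castSucc, Fin.val_succ, Fin.val_last]
        grind
    have h4 : G ((Fin.last (q + 1)).succ.insertNth a (b ∘ finRotate (q + 2))) =
        G ((0 : Fin (q + 2)).succ.insertNth a b) := by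
      rw [← neg_neg (G ((0 : Fin (q + 2)).succ.insertNth a b)), ← hrot, ← hrot]
      congr 1
      refine insertNth_comp_eq (finRotate (q + 3) * finRotate (q + 3)) (finRotate (q + 2)) a b ?_
        fun j => ?_
      · ext
        simp
      · ext
        simp only [Equiv.Perm.mul_apply, coe_finRotate, Fin.succAbove, Fin.ext_iff, Fin.lt_def,
          apply_ite Fin.val, Fin.val_castSucc, Fin.val_succ, Fin.val_last, Fin.val_zero]
        grind
    rw [Finset.sum_congr rfl fun i _ => h3 i, h4, Finset.sum_neg_distrib] at h2
    linarith
  rw [← Fin.insertNth_self_removeNth (α := fun _ => X) (0 : Fin (q + 2)).succ w]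
  exact key _ _

theorem extQ_of_lt {m : ℕ} (x : Fin m → ℚ) {i : ℕ} (h : i < m) : extQ x i = x ⟨i, h⟩ := dif_pos h

theorem extQ_of_le {m : ℕ} (x : Fin m → ℚ) {i : ℕ} (h : m ≤ i) : extQ x i = 0 :=
  dif_neg (by omega)

theorem extG_of_lt {m : ℕ} (σ : Fin m → Γ) {i : ℕ} (h : i < m) : extG σ i = σ ⟨i, h⟩ := dif_pos h

theorem prod_range_extG {m : ℕ} (σ : Fin m → Γ) : ∏ j ∈ Finset.range m, extG σ j = ∏ j, σ j := by
  rw [Finset.prod_range]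
  exact Finset.prod_congr rfl fun j _ => extG_of_lt σ j.isLt

/-- If `M` is alternal, then `swap(M)` is invariant, up to sign, under `swap ∘ mantar ∘ swap`. -/
theorem IsAlternal.swapM_eq {M : Mould Γ} (h : IsAlternal M) (n : ℕ) (σ : Fin (n + 1) → Γ)
    (v : Fin (n + 1) → ℚ) :
    swapM M (n + 1) σ v = (-1) ^ n * swapM M (n + 1)
      (fun j => if j = 0 then ∏ i, σ i else (extG σ (n + 1 - j))⁻¹)
      (fun j => v 0 - extQ v (n + 1 - j)) := by
  rw [swapM, h.mantar, swapM]
  congr 2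
  · ext i
    have key : ∀ t ≤ n, ∏ j ∈ Finset.range (t + 1),
        extG (fun j : Fin (n + 1) => if j = 0 then ∏ i, σ i else (extG σ (n + 1 - j))⁻¹) j =
          ∏ j ∈ Finset.range (n + 1 - t), extG σ j := by
      intro t
      induction t with
      | zero => simp [extG_of_lt, prod_range_extG]
      | succ t ih =>
        intro ht
        rw [Finset.prod_range_succ, ih (by omega), extG_of_lt _ (by omega : t + 1 < n + 1),
          if_neg (by simp [Fin.ext_iff]), (by omega : n + 1 - t = n + 1 - (t + 1) + 1),
          Finset.prod_range_succ, mul_inv_cancel_right]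
    have hi := i.isLt
    rw [(by omega : n + 1 - i.val = n - i.val + 1), key _ (by omega), Fin.val_rev]
    congr 2
    omega
  · ext i
    have hi := i.isLt
    have key : ∀ t ≤ n + 1, extQ (fun j : Fin (n + 1) => v 0 - extQ v (n + 1 - j)) t =
        if t = n + 1 then 0 else v 0 - extQ v (n + 1 - t) := by
      intro t ht
      split_ifs with h'
      · exact extQ_of_le _ h'.ge
      · rw [extQ_of_lt _ (by omega)]
    rw [key _ (by omega), key _ (by omega), if_neg (by omega), Fin.val_rev,
      (by omega : n + 1 - 1 - (n + 1 - (i.val + 1)) = i.val),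
      (by omega : n + 1 - (n + 1 - (i.val + 1)) = i.val + 1),
      (by omega : n + 1 - (n + 1 - 1 - i.val) = i.val + 1)]
    split_ifs with h0
    · rw [(by omega : i.val = 0), extQ_of_lt v n.succ_pos]
      simp
    · rw [(by omega : n + 1 - (n + 1 - i.val) = i.val)]
      ring

/-- Invariance of `swap(M)` under `neg ∘ push`. -/
theorem swapM_neg_push {M : Mould Γ} (h : IsAlternal M) (hs : IsAlternal (swapM M)) (n : ℕ)
    (σ : Fin (n + 1) → Γ) (v : Fin (n + 1) → ℚ) :
    swapM M (n + 1) σ v = swapM M (n + 1)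
      (fun j => if j = Fin.last n then ∏ i, σ i else (extG σ (j + 1))⁻¹)
      (fun j => v 0 - extQ v (j + 1)) := by
  rw [h.swapM_eq, hs.mantar, ← mul_assoc, ← mul_pow, neg_one_mul, neg_neg, one_pow, one_mul]
  congr 1
  · ext j
    have hj := j.isLt
    rw [Fin.val_rev, (by omega : n + 1 - (n + 1 - (j.val + 1)) = j.val + 1)]
    simp only [Fin.rev_eq_iff, Fin.rev_zero]
  · ext j
    have hj := j.isLt
    rw [Fin.val_rev, (by omega : n + 1 - (n + 1 - (j.val + 1)) = j.val + 1)]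

/-- The translation invariant extension of the depth-`n` component of a mould to words of
length `n + 1`. -/
def cyclicExt {Γ : Type} (N : Mould Γ) (n : ℕ) (w : Fin (n + 1) → Γ × ℚ) : ℚ :=
  N n (fun j => (w j.succ).1) (fun j => (w j.succ).2 - (w 0).2)

/-- The operator `neg` on letters. -/
def negLetter (p : Γ × ℚ) : Γ × ℚ := (p.1⁻¹, -p.2)

theorem negLetter_negLetter (p : Γ × ℚ) : negLetter (negLetter p) = p := by
  simp [negLetter]

theorem cyclicExt_rotate {M : Mould Γ} (h : IsAlternal M) (hs : IsAlternal (swapM M)) (n : ℕ)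
    (w : Fin (n + 2) → Γ × ℚ) (hw : ∏ i, (w i).1 = 1) :
    cyclicExt (swapM M) (n + 1) (w ∘ finRotate (n + 2)) =
      cyclicExt (swapM M) (n + 1) (negLetter ∘ w) := by
  rw [cyclicExt, cyclicExt, swapM_neg_push h hs n (fun j => ((negLetter ∘ w) j.succ).1)]
  rw [Fin.prod_univ_succ] at hw
  congr 1
  · ext j
    rcases eq_or_ne j (Fin.last n) with rfl | hj
    · simp only [if_true, Function.comp_apply, negLetter, Finset.prod_inv_distrib, Fin.succ_last,
        finRotate_last]
      exact eq_inv_of_mul_eq_one_left hw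
    · have hj' : j.val + 1 < n + 1 := by
        have := Fin.val_ne_of_ne hj
        simp at this
        omega
      rw [if_neg hj, extG_of_lt _ hj']
      simp only [Function.comp_apply, negLetter, inv_inv]
      congr 2
      ext
      rw [coe_finRotate, if_neg (by simpa [Fin.ext_iff] using hj)]
      simp
  · ext j
    rcases eq_or_ne j (Fin.last n) with rfl | hj
    · rw [extQ_of_le _ (by simp)]
      simp only [Function.comp_apply, Fin.succ_last, finRotate_last, finRotate_apply_zero, negLetter,
        Fin.succ_zero_eq_one]
      ring
    · have hj' : j.val + 1 < n + 1 := by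
        have := Fin.val_ne_of_ne hj
        simp at this
        omega
      have : finRotate (n + 2) j.succ = Fin.succ ⟨j.val + 1, hj'⟩ := by
        ext
        rw [coe_finRotate, if_neg (by simpa [Fin.ext_iff] using hj)]
        simp
      rw [extQ_of_lt _ hj', Function.comp_apply, this, Function.comp_apply, finRotate_apply_zero]
      simp only [Function.comp_apply, negLetter, Fin.succ_zero_eq_one]
      ring

theorem sum_cyclicExt_insertNth {Γ : Type} {N : Mould Γ} (h : IsAlternal N) {q : ℕ} (a : Γ × ℚ)
    (b : Fin (q + 2) → Γ × ℚ) :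
    ∑ i : Fin (q + 2), cyclicExt N (q + 2) (i.succ.insertNth a b) = 0 := by
  rw [← h.sum_insertNth (by omega) (a.1, a.2 - (b 0).2)
    (fun j : Fin (q + 1) => ((b j.succ).1, (b j.succ).2 - (b 0).2))]
  refine Finset.sum_congr rfl fun i _ => ?_
  have hb : b = Fin.cons (b 0) (Fin.tail b) := (Fin.cons_self_tail b).symm
  have hw : ∀ j, (i.succ.insertNth a b : Fin (q + 3) → Γ × ℚ) (Fin.succ j) =
      (i.insertNth a (Fin.tail b) : Fin (q + 2) → Γ × ℚ) j := by
    intro j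
    rw [hb, Fin.insertNth_succ_cons]
    rfl
  have h0 : (i.succ.insertNth a b : Fin (q + 3) → Γ × ℚ) 0 = b 0 := by
    rw [hb, Fin.insertNth_succ_cons]
    rfl
  have hf := comp_insertNth (fun p : Γ × ℚ => (p.1, p.2 - (b 0).2)) i a (Fin.tail b)
  have hsnd : (fun j => ((i.insertNth a (Fin.tail b) : Fin (q + 2) → Γ × ℚ) j).2 - (b 0).2) =
      fun j => ((i.insertNth (a.1, a.2 - (b 0).2)
        (fun j : Fin (q + 1) => ((b j.succ).1, (b j.succ).2 - (b 0).2)) : _ → Γ × ℚ) j).2 :=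
    funext fun j => (Prod.ext_iff.1 (congrFun hf j)).2
  have hfst : (fun j => ((i.insertNth a (Fin.tail b) : Fin (q + 2) → Γ × ℚ) j).1) =
      fun j => ((i.insertNth (a.1, a.2 - (b 0).2)
        (fun j : Fin (q + 1) => ((b j.succ).1, (b j.succ).2 - (b 0).2)) : _ → Γ × ℚ) j).1 :=
    funext fun j => (Prod.ext_iff.1 (congrFun hf j)).1
  simp only [cyclicExt, hw, h0]
  rw [hsnd, hfst]

theorem cyclicExt_negLetter {M : Mould Γ} (h : IsAlternal M) (hs : IsAlternal (swapM M)) (q : ℕ)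
    (w : Fin (q + 3) → Γ × ℚ) (hw : ∏ i, (w i).1 = 1) :
    cyclicExt (swapM M) (q + 2) w = cyclicExt (swapM M) (q + 2) (negLetter ∘ w) := by
  classical
  let G : (Fin (q + 3) → Γ × ℚ) → ℚ := fun w => if ∏ i, (w i).1 = 1 then
    cyclicExt (swapM M) (q + 2) w - cyclicExt (swapM M) (q + 2) (negLetter ∘ w) else 0
  have hG : G w = 0 := by
    refine eq_zero_of_rotate_eq_neg G (fun w => ?_) (fun a b => ?_) w
    · have hprod : ∏ i, ((w ∘ finRotate (q + 3)) i).1 = ∏ i, (w i).1 :=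
        Equiv.prod_comp (finRotate (q + 3)) fun i => (w i).1
      simp only [G, hprod]
      split_ifs with hw
      · have hn : ∏ i, ((negLetter ∘ w) i).1 = 1 := by simp [negLetter, hw]
        have hnn : negLetter ∘ negLetter ∘ w = w := funext fun i => negLetter_negLetter (w i)
        rw [cyclicExt_rotate h hs _ _ hw, ← Function.comp_assoc, cyclicExt_rotate h hs _ _ hn, hnn]
        ring
      · simp
    · have hprod : ∀ i : Fin (q + 2), ∏ j, ((i.succ.insertNth a b : _ → Γ × ℚ) j).1 =
          a.1 * ∏ j, (b j).1 := by
        intro i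
        rw [Fin.prod_univ_succAbove _ i.succ]
        simp
      have hneg : ∀ i : Fin (q + 2), negLetter ∘ (i.succ.insertNth a b : Fin (q + 3) → Γ × ℚ) =
          (i.succ.insertNth (negLetter a) fun j => negLetter (b j) : Fin (q + 3) → Γ × ℚ) :=
        fun i => comp_insertNth _ _ _ _
      simp only [G, hprod]
      split_ifs
      · rw [Finset.sum_sub_distrib]
        simp only [hneg]
        rw [sum_cyclicExt_insertNth hs, sum_cyclicExt_insertNth hs, sub_zero]
      · simp
  simp only [G, if_pos hw] at hG
  exact sub_eq_zero.1 hG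

/-- For bialternal `M`, `swap(M)` is `neg`-invariant. -/
theorem IsBialternal.swapM_neg {M : Mould Γ} (h : IsBialternal M) (n : ℕ) (σ : Fin (n + 1) → Γ)
    (v : Fin (n + 1) → ℚ) :
    swapM M (n + 1) σ v = swapM M (n + 1) (fun j => (σ j)⁻¹) (fun j => -(v j)) := by
  obtain ⟨hM, hs, heven⟩ := h
  rcases n with _ | q
  · have h1 := heven (σ 0) (v 0)
    simpa [swapM, extG, extQ, Subsingleton.elim _ (0 : Fin 1)] using h1
  · have h1 := cyclicExt_negLetter hM hs q
      (Fin.cons ((∏ i, σ i)⁻¹, 0) fun j => (σ j, v j)) (by simp [Fin.prod_univ_succ])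
    simpa [cyclicExt, negLetter] using h1

/-- Lemma: for a bialternal `M ∈ ARI(Γ)`, `swap(M)` is `neg`-invariant and
`mantar∘neg`-invariant. -/
theorem swap_neg_mantar_invariant (Γ : Type) [CommGroup Γ] [Fintype Γ]
    (M : Mould Γ) (hM : IsARI M) (hbal : IsBialternal M)
    (m : ℕ) (hm : 1 ≤ m) (σ : Fin m → Γ) (v : Fin m → ℚ) :
    (swapM M m σ v = swapM M m (fun j => (σ j)⁻¹) (fun j => -(v j))) ∧
    (swapM M m σ v = (-1 : ℚ) ^ (m - 1) *
      swapM M m (fun j => (σ j.rev)⁻¹) (fun j => -(v j.rev))) := by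
  obtain ⟨n, rfl⟩ := Nat.exists_eq_add_of_le' hm
  have hneg := hbal.swapM_neg n σ v
  exact ⟨hneg, hneg.trans (hbal.2.1.mantar n _ _)⟩

end KVMould
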